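/- Let n ≥ 1 and r ≥ 1 be integers. There exists a positive integer M such that for every integer m ≥ M the following holds: setting P = Pyr^r(T_m) × [0,n]^n ⊆ ℝ^{n+r+3} (a full-dimensional integral polytope of dimension n+r+3), there is a polynomial p of degree n+r+3 with rational coefficients and constant coefficient 1 such that i(P,t) = p(t) for every positive integer t and the coefficient of t^j in p is negative for every j with 1 ≤ j ≤ n+1. -/

import Mathlib

open scoped Pointwise BigOperators

/-- `P` is an integral polytope: the convex hull of finitely many points
with integer coordinates. -/
def IsIntegralPolytope {N : ℕ} (P : Set (Fin N → ℝ)) : Prop :=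
  ∃ V : Finset (Fin N → ℝ),
    (∀ v ∈ V, ∀ i, ∃ z : ℤ, v i = (z : ℝ)) ∧
    P = convexHull ℝ (V : Set (Fin N → ℝ))

/-- `latticeCount P t = i(P,t)`: the number of points of `ℤ^N` in the dilate `t • P`. -/
noncomputable def latticeCount {N : ℕ} (P : Set (Fin N → ℝ)) (t : ℕ) : ℕ :=
  Set.ncard {x : Fin N → ℝ | x ∈ (t : ℝ) • P ∧ ∀ i, ∃ z : ℤ, x i = (z : ℝ)}

/-- The Reeve tetrahedron `T_m ⊆ ℝ³`. -/
def reeve (m : ℕ) : Set (Fin 3 → ℝ) :=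
  convexHull ℝ {![0, 0, 0], ![1, 0, 0], ![0, 1, 0], ![1, 1, (m : ℝ)]}

/-- The pyramid over a polytope `P ⊆ ℝⁿ`: the convex hull of `P × {0}` together
with the apex `(0,…,0,1)`. -/
def pyr {n : ℕ} (P : Set (Fin n → ℝ)) : Set (Fin (n + 1) → ℝ) :=
  convexHull ℝ ((fun x => Fin.snoc x (0 : ℝ)) '' P ∪ {Fin.snoc (0 : Fin n → ℝ) 1})

/-- The `k`-fold iterated pyramid, `Pyr^k(P)`. -/
def pyrIter {n : ℕ} : (k : ℕ) → Set (Fin n → ℝ) → Set (Fin (n + k) → ℝ)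
  | 0, P => P
  | k + 1, P => pyr (pyrIter k P)

/-- Cartesian product of polytopes, `P × Q ⊆ ℝ^{a+b}`. -/
def setProd {a b : ℕ} (P : Set (Fin a → ℝ)) (Q : Set (Fin b → ℝ)) :
    Set (Fin (a + b) → ℝ) :=
  {z | (fun i => z (Fin.castAdd b i)) ∈ P ∧ (fun j => z (Fin.natAdd a j)) ∈ Q}

/-- The hypercube `[0,n]^n ⊆ ℝⁿ`. -/
def cube (n : ℕ) : Set (Fin n → ℝ) := {x | ∀ i, x i ∈ Set.Icc (0 : ℝ) (n : ℝ)}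

/-- The rising product `(X + 1)(X + 2)⋯(X + k)`. -/
noncomputable def risingProd (k : ℕ) : Polynomial ℚ :=
  ∏ i ∈ Finset.range k, (Polynomial.X + Polynomial.C ((i : ℚ) + 1))

section Polynomials

open Polynomial

lemma risingProd_succ (k : ℕ) :
    risingProd (k + 1) = risingProd k * (X + C ((k : ℚ) + 1)) :=
  Finset.prod_range_succ _ _

lemma risingProd_monic (k : ℕ) : (risingProd k).Monic :=
  monic_prod_of_monic _ _ fun _ _ => monic_X_add_C _

lemma risingProd_natDegree (k : ℕ) : (risingProd k).natDegree = k := by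
  rw [risingProd, natDegree_prod_of_monic _ _ fun _ _ => monic_X_add_C _]
  simp only [natDegree_X_add_C, Finset.sum_const, Finset.card_range, smul_eq_mul, mul_one]

lemma risingProd_coeff_nonneg (k i : ℕ) : 0 ≤ (risingProd k).coeff i := by
  induction k generalizing i with
  | zero =>
    simp only [risingProd, Finset.range_zero, Finset.prod_empty, coeff_one]
    split_ifs <;> simp
  | succ k ih =>
    rw [risingProd_succ, mul_add, coeff_add, coeff_mul_C]
    have h : 0 ≤ (risingProd k * X).coeff i := by
      cases i with
      | zero => simp
      | succ i => rw [coeff_mul_X]; exact ih i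
    have := ih i
    positivity

lemma risingProd_coeff_pos {k i : ℕ} (hi : i ≤ k) : 0 < (risingProd k).coeff i := by
  induction k generalizing i with
  | zero =>
    obtain rfl : i = 0 := by omega
    simp [risingProd]
  | succ k ih =>
    rw [risingProd_succ, mul_add, coeff_add, coeff_mul_C]
    have h := risingProd_coeff_nonneg k i
    cases i with
    | zero =>
      have := ih (Nat.zero_le k)
      rw [coeff_mul_X_zero, zero_add]
      positivity
    | succ i =>
      have := ih (i := i) (by omega)
      rw [coeff_mul_X]
      positivity

lemma risingProd_eval (k t : ℕ) :
    (risingProd k).eval (t : ℚ) = k.factorial * (t + k).choose k := by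
  induction k with
  | zero => simp [risingProd]
  | succ k ih =>
    have h := Nat.add_one_mul_choose_eq (t + k) k
    have h' : ((t : ℚ) + k + 1) * (t + k).choose k = (t + (k + 1)).choose (k + 1) * (k + 1) := by
      exact_mod_cast h
    rw [risingProd_succ, eval_mul, ih, Nat.factorial_succ]
    simp only [eval_add, eval_X, eval_C]
    push_cast
    linear_combination (k.factorial : ℚ) * h'

lemma shifted_risingProd_eval (k t : ℕ) :
    (X * ((X - 1) * risingProd k) : ℚ[X]).eval (t : ℚ) =
      (k + 2).factorial * (t + k).choose (k + 2) := by
  induction k with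
  | zero =>
    have := Nat.cast_choose_two ℚ t
    simp [risingProd, this]
    ring
  | succ k ih =>
    have h := Nat.add_one_mul_choose_eq (t + k) (k + 2)
    have h' : ((t : ℚ) + k + 1) * (t + k).choose (k + 2) =
        (t + (k + 1)).choose (k + 1 + 2) * (k + 2 + 1) := by
      exact_mod_cast h
    have e : (X * ((X - 1) * risingProd (k + 1)) : ℚ[X]).eval (t : ℚ) =
        (X * ((X - 1) * risingProd k) : ℚ[X]).eval (t : ℚ) * (t + k + 1) := by
      rw [risingProd_succ]
      simp only [eval_mul, eval_add, eval_X, eval_C]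
      ring
    rw [e, ih, show k + 1 + 2 = (k + 2) + 1 by ring, Nat.factorial_succ (k + 2)]
    push_cast
    linear_combination ((k + 2).factorial : ℚ) * h'

lemma coeff_linear_pow (n j : ℕ) :
    ((C (n : ℚ) * X + 1) ^ n).coeff j = n.choose j * (n : ℚ) ^ j := by
  have h : (C (n : ℚ) * X + 1) ^ n = ((X + 1) ^ n).comp (C (n : ℚ) * X) := by simp
  rw [h, comp_C_mul_X_coeff, coeff_X_add_one_pow]

lemma linear_pow_mul_coeff_succ (n j : ℕ) :
    ((j : ℚ) + 1) * ((C (n : ℚ) * X + 1) ^ n * (X - 1)).coeff (j + 1) =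
      - (n.choose j * (n : ℚ) ^ j * (((n : ℚ) - j) * n - (j + 1))) := by
  rw [mul_sub, mul_one, coeff_sub, coeff_mul_X, coeff_linear_pow, coeff_linear_pow]
  have h : (n.choose (j + 1) : ℚ) * (j + 1) = n.choose j * ((n : ℚ) - j) := by
    rcases le_or_gt j n with hj | hj
    · rw [← Nat.cast_sub hj]
      exact_mod_cast Nat.choose_succ_right_eq n j
    · rw [Nat.choose_eq_zero_of_lt hj, Nat.choose_eq_zero_of_lt (by omega : n < j + 1)]
      simp
  rw [pow_succ]
  linear_combination (-(n : ℚ) ^ j * n) * h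

lemma linear_pow_mul_coeff_neg {n j : ℕ} (hj : j < n) :
    ((C (n : ℚ) * X + 1) ^ n * (X - 1)).coeff j < 0 := by
  cases j with
  | zero =>
    have := coeff_linear_pow n 0
    rw [mul_sub, mul_one, coeff_sub, coeff_mul_X_zero, this]
    simp
  | succ j =>
    have h := linear_pow_mul_coeff_succ n j
    have hc : (0 : ℚ) < n.choose j := by exact_mod_cast Nat.choose_pos (by omega)
    have hn : (0 : ℚ) < n := by exact_mod_cast (by omega : 0 < n)
    have hj' : (j : ℚ) + 2 ≤ n := by exact_mod_cast hj
    have : (0 : ℚ) < ((n : ℚ) - j) * n - (j + 1) := by nlinarith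
    have : 0 < (n.choose j * (n : ℚ) ^ j * (((n : ℚ) - j) * n - (j + 1))) := by positivity
    by_contra! hcon
    have : (0 : ℚ) ≤ ((j : ℚ) + 1) * ((C (n : ℚ) * X + 1) ^ n * (X - 1)).coeff (j + 1) := by
      positivity
    linarith

lemma linear_pow_mul_coeff_nonpos {n j : ℕ} (hj : j ≤ n) :
    ((C (n : ℚ) * X + 1) ^ n * (X - 1)).coeff j ≤ 0 := by
  rcases hj.lt_or_eq with hj | rfl
  · exact (linear_pow_mul_coeff_neg hj).le
  · cases j with
    | zero => simp
    | succ j =>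
      have h := linear_pow_mul_coeff_succ (j + 1) j
      have h0 : ((j : ℚ) + 1) *
          ((C ((j + 1 : ℕ) : ℚ) * X + 1) ^ (j + 1) * (X - 1)).coeff (j + 1) = 0 := by
        rw [h]; push_cast; ring
      rcases mul_eq_zero.mp h0 with h1 | h1
      · exact absurd h1 (by positivity)
      · exact h1.le

lemma linear_pow_mul_risingProd_coeff_neg {n k j : ℕ} (hn : 1 ≤ n) (hk : 1 ≤ k) (hj : j ≤ n) :
    ((C (n : ℚ) * X + 1) ^ n * (X - 1) * risingProd k).coeff j < 0 := by
  rw [coeff_mul]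
  refine Finset.sum_neg' (fun p hp => ?_) ?_
  · have := Finset.HasAntidiagonal.mem_antidiagonal.mp hp
    exact mul_nonpos_of_nonpos_of_nonneg (linear_pow_mul_coeff_nonpos (by omega))
      (risingProd_coeff_nonneg _ _)
  · rcases hj.lt_or_eq with hj | rfl
    · exact ⟨(j, 0), by simp, mul_neg_of_neg_of_pos (linear_pow_mul_coeff_neg hj)
        (risingProd_coeff_pos (Nat.zero_le _))⟩
    · exact ⟨(j - 1, 1), by simp; omega, mul_neg_of_neg_of_pos
        (linear_pow_mul_coeff_neg (by simp; omega)) (risingProd_coeff_pos hk)⟩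

/-- The Ehrhart polynomial of `Pyr^r(T_{m+1}) × [0,n]^n`. -/
noncomputable def pyrReevePoly (n r m : ℕ) : ℚ[X] :=
  C ((r + 3).factorial : ℚ)⁻¹ * ((C (n : ℚ) * X + 1) ^ n *
    (risingProd (r + 3) + C (m : ℚ) * (X * ((X - 1) * risingProd (r + 1)))))

lemma pyrReevePoly_eval (n r m t : ℕ) :
    (pyrReevePoly n r m).eval (t : ℚ) =
      ((t + r + 3).choose (r + 3) + m * (t + r + 1).choose (r + 3)) * (n * t + 1) ^ n := by
  have h1 := risingProd_eval (r + 3) t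
  have h2 := shifted_risingProd_eval (r + 1) t
  rw [pyrReevePoly, eval_mul, eval_mul, eval_add, eval_mul (p := C (m : ℚ)), h1, h2]
  have : ((r + 3).factorial : ℚ) ≠ 0 := by positivity
  simp only [eval_pow, eval_add, eval_mul, eval_C, eval_X, eval_one]
  rw [show r + 1 + 2 = r + 3 by ring, ← add_assoc, ← add_assoc]
  field_simp

lemma pyrReevePoly_coeff_zero (n r m : ℕ) : (pyrReevePoly n r m).coeff 0 = 1 := by
  have h := pyrReevePoly_eval n r m 0
  rw [coeff_zero_eq_eval_zero]
  simpa [Nat.choose_eq_zero_of_lt (by omega : r + 1 < r + 3)] using h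

lemma pyrReevePoly_natDegree {n : ℕ} (hn : 1 ≤ n) (r m : ℕ) :
    (pyrReevePoly n r m).natDegree = n + r + 3 := by
  have hn0 : (n : ℚ) ≠ 0 := by exact_mod_cast (by omega : n ≠ 0)
  have hlin : (C (n : ℚ) * X + 1).natDegree = 1 := by
    simpa using natDegree_linear (b := (1 : ℚ)) hn0
  have hmon : (X * ((X - 1) * risingProd (r + 1)) : ℚ[X]).Monic :=
    monic_X.mul ((monic_X_sub_C (1 : ℚ)).mul (risingProd_monic _))
  have hdeg : (X * ((X - 1) * risingProd (r + 1)) : ℚ[X]).natDegree = r + 3 := by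
    rw [← C_1, monic_X.natDegree_mul ((monic_X_sub_C (1 : ℚ)).mul (risingProd_monic _)),
      (monic_X_sub_C (1 : ℚ)).natDegree_mul (risingProd_monic _), natDegree_X,
      natDegree_X_sub_C, risingProd_natDegree]
    ring
  have hcoeff : (risingProd (r + 3) +
      C (m : ℚ) * (X * ((X - 1) * risingProd (r + 1)))).coeff (r + 3) = (1 + m : ℚ) := by
    have h1 := (risingProd_monic (r + 3)).coeff_natDegree
    have h2 := hmon.coeff_natDegree
    rw [risingProd_natDegree] at h1
    rw [hdeg] at h2
    rw [coeff_add, coeff_C_mul, h1, h2, mul_one]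
  have hsum : (risingProd (r + 3) +
      C (m : ℚ) * (X * ((X - 1) * risingProd (r + 1)))).natDegree = r + 3 := by
    refine natDegree_eq_of_le_of_coeff_ne_zero ?_ ?_
    · refine natDegree_add_le_of_degree_le (risingProd_natDegree _).le ?_
      exact (natDegree_C_mul_le _ _).trans hdeg.le
    · rw [hcoeff]; positivity
  have h0 : (C (n : ℚ) * X + 1) ^ n ≠ 0 := by
    refine pow_ne_zero _ fun h => ?_
    rw [h] at hlin
    simp at hlin
  have h1 : (risingProd (r + 3) +
      C (m : ℚ) * (X * ((X - 1) * risingProd (r + 1)))) ≠ 0 := by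
    intro h
    rw [h, natDegree_zero] at hsum
    omega
  rw [pyrReevePoly, natDegree_C_mul (by positivity), natDegree_mul h0 h1, natDegree_pow, hlin,
    hsum]
  ring

lemma exists_pyrReevePoly_coeff_neg {n r : ℕ} (hn : 1 ≤ n) :
    ∃ M : ℕ, ∀ m : ℕ, M ≤ m → ∀ j : ℕ, 1 ≤ j → j ≤ n + 1 → (pyrReevePoly n r m).coeff j < 0 := by
  have key : ∀ j ∈ Finset.Icc 1 (n + 1),
      ∀ᶠ m : ℕ in Filter.atTop, (pyrReevePoly n r m).coeff j < 0 := by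
    intro j hj
    rw [Finset.mem_Icc] at hj
    obtain ⟨i, rfl⟩ : ∃ i, j = i + 1 := ⟨j - 1, by omega⟩
    have hneg := linear_pow_mul_risingProd_coeff_neg (j := i) hn
      (by omega : 1 ≤ r + 1) (by omega)
    set a := ((C (n : ℚ) * X + 1) ^ n * risingProd (r + 3)).coeff (i + 1)
    set b := ((C (n : ℚ) * X + 1) ^ n * (X - 1) * risingProd (r + 1)).coeff i
    have hp : ∀ m : ℕ, (pyrReevePoly n r m).coeff (i + 1) =
        ((r + 3).factorial : ℚ)⁻¹ * (a + m * b) := by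
      intro m
      have hmul : (C (n : ℚ) * X + 1) ^ n * (C (m : ℚ) * (X * ((X - 1) * risingProd (r + 1)))) =
          C (m : ℚ) * ((C (n : ℚ) * X + 1) ^ n * (X - 1) * risingProd (r + 1) * X) := by
        ring
      rw [pyrReevePoly, coeff_C_mul, mul_add, coeff_add, hmul, coeff_C_mul, coeff_mul_X]
    obtain ⟨M, hM⟩ := exists_nat_gt (a / (-b))
    filter_upwards [Filter.eventually_ge_atTop M] with m hm
    have hm' : a / (-b) < m := hM.trans_le (by exact_mod_cast hm)
    rw [div_lt_iff₀ (by linarith)] at hm'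
    rw [hp]
    exact mul_neg_of_pos_of_neg (by positivity) (by linarith)
  obtain ⟨M, hM⟩ := Filter.eventually_atTop.mp ((Filter.eventually_all_finset _).mpr key)
  exact ⟨M, fun m hm j h1 h2 => hM m hm j (Finset.mem_Icc.mpr ⟨h1, h2⟩)⟩

end Polynomials

section Geometry

/-- The points of `ℤ^N` in `t • P`, as integer vectors. -/
def latticePoints {N : ℕ} (P : Set (Fin N → ℝ)) (t : ℕ) : Set (Fin N → ℤ) :=
  {z | (fun i => (z i : ℝ)) ∈ (t : ℝ) • P}

lemma latticeCount_eq_card {N : ℕ} (P : Set (Fin N → ℝ)) (t : ℕ) :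
    latticeCount P t = Nat.card (latticePoints P t) := by
  have hinj : Function.Injective fun (z : Fin N → ℤ) (i : Fin N) => (z i : ℝ) := by
    intro a b h
    funext i
    exact Int.cast_injective (congrFun h i)
  rw [Nat.card_coe_set_eq, ← Set.ncard_image_of_injective _ hinj, latticeCount]
  congr 1
  ext x
  constructor
  · rintro ⟨hx, hz⟩
    choose z hz using hz
    obtain rfl : x = fun i => (z i : ℝ) := funext hz
    exact ⟨z, hx, rfl⟩
  · rintro ⟨z, hz, rfl⟩
    exact ⟨hz, fun i => ⟨z i, rfl⟩⟩

/-- The embedding `x ↦ (x, 0)` of `ℝⁿ` into `ℝⁿ⁺¹`. -/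
def snocZero (n : ℕ) : (Fin n → ℝ) →ₗ[ℝ] (Fin (n + 1) → ℝ) where
  toFun x := Fin.snoc x (0 : ℝ)
  map_add' x y := by
    funext i
    refine Fin.lastCases ?_ (fun i => ?_) i <;> simp
  map_smul' c x := by
    funext i
    refine Fin.lastCases ?_ (fun i => ?_) i <;> simp

/-- Concatenation `ℝᵃ × ℝᵇ → ℝᵃ⁺ᵇ`. -/
def appendLinear (a b : ℕ) : (Fin a → ℝ) × (Fin b → ℝ) →ₗ[ℝ] (Fin (a + b) → ℝ) where
  toFun x := Fin.append x.1 x.2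
  map_add' x y := by
    funext i
    refine Fin.addCases (fun i => ?_) (fun i => ?_) i <;> simp
  map_smul' c x := by
    funext i
    refine Fin.addCases (fun i => ?_) (fun i => ?_) i <;> simp

lemma snoc_eq_smul_add_smul {n : ℕ} (x : Fin n → ℝ) (a w : ℝ) :
    (Fin.snoc (a • x) w : Fin (n + 1) → ℝ) =
      a • snocZero n x + w • (Fin.snoc (0 : Fin n → ℝ) 1 : Fin (n + 1) → ℝ) := by
  funext i
  refine Fin.lastCases ?_ (fun i => ?_) i <;> simp [snocZero]

lemma setProd_eq_image {a b : ℕ} (P : Set (Fin a → ℝ)) (Q : Set (Fin b → ℝ)) :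
    setProd P Q = appendLinear a b '' (P ×ˢ Q) := by
  ext z
  constructor
  · rintro ⟨h1, h2⟩
    exact ⟨(_, _), ⟨h1, h2⟩, Fin.append_castAdd_natAdd⟩
  · rintro ⟨⟨x, y⟩, ⟨hx, hy⟩, rfl⟩
    exact ⟨by simpa [appendLinear] using hx, by simpa [appendLinear] using hy⟩

lemma pyr_eq_convexHull_image_union {n : ℕ} (P : Set (Fin n → ℝ)) :
    pyr P = convexHull ℝ (snocZero n '' P ∪ {Fin.snoc (0 : Fin n → ℝ) 1}) := rfl

lemma mem_pyr_iff {n : ℕ} {P : Set (Fin n → ℝ)} (hP : Convex ℝ P) (hne : P.Nonempty)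
    (x : Fin (n + 1) → ℝ) :
    x ∈ pyr P ↔ 0 ≤ x (Fin.last n) ∧ x (Fin.last n) ≤ 1 ∧
      (Fin.init x : Fin n → ℝ) ∈ (1 - x (Fin.last n)) • P := by
  constructor
  · intro hx
    refine convexHull_min (t := {x | 0 ≤ x (Fin.last n) ∧ x (Fin.last n) ≤ 1 ∧
      (Fin.init x : Fin n → ℝ) ∈ (1 - x (Fin.last n)) • P}) ?_ ?_ hx
    · rintro _ (⟨y, hy, rfl⟩ | rfl)
      · simpa using hy
      · simp [Set.zero_smul_set hne]
    · rintro y ⟨hy0, hy1, hy⟩ z ⟨hz0, hz1, hz⟩ a b ha hb hab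
      have hlast : (a • y + b • z) (Fin.last n) = a * y (Fin.last n) + b * z (Fin.last n) := rfl
      refine ⟨?_, ?_, ?_⟩
      · rw [hlast]; positivity
      · rw [hlast]; nlinarith
      · have hs : 1 - (a • y + b • z) (Fin.last n) =
            a * (1 - y (Fin.last n)) + b * (1 - z (Fin.last n)) := by
          rw [hlast]; linear_combination -hab
        rw [hs, hP.add_smul (mul_nonneg ha (by linarith)) (mul_nonneg hb (by linarith)),
          mul_smul, mul_smul]
        exact Set.add_mem_add (Set.smul_mem_smul_set hy) (Set.smul_mem_smul_set hz)
  · rintro ⟨h0, h1, p, hp, hpx⟩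
    have hx : x = Fin.snoc ((1 - x (Fin.last n)) • p) (x (Fin.last n)) := by
      rw [show (1 - x (Fin.last n)) • p = (Fin.init x : Fin n → ℝ) from hpx, Fin.snoc_init_self]
    rw [hx, snoc_eq_smul_add_smul]
    have hc : Convex ℝ (pyr P) := convex_convexHull ℝ _
    exact hc (subset_convexHull ℝ _ (Or.inl ⟨p, hp, rfl⟩))
      (subset_convexHull ℝ _ (Or.inr rfl)) (by linarith) h0 (by ring)

lemma mem_smul_pyr_iff {n : ℕ} {P : Set (Fin n → ℝ)} (hP : Convex ℝ P) (hne : P.Nonempty)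
    {t : ℝ} (ht : 0 ≤ t) (x : Fin (n + 1) → ℝ) :
    x ∈ t • pyr P ↔ 0 ≤ x (Fin.last n) ∧ x (Fin.last n) ≤ t ∧
      (Fin.init x : Fin n → ℝ) ∈ (t - x (Fin.last n)) • P := by
  rcases ht.eq_or_lt with rfl | ht
  · have hpyr : (pyr P).Nonempty := ⟨_, subset_convexHull ℝ _ (Or.inr rfl)⟩
    rw [Set.zero_smul_set hpyr, Set.mem_zero]
    constructor
    · rintro rfl
      simp [Set.zero_smul_set hne]
      rfl
    · rintro ⟨h0, h1, h2⟩
      have hl : x (Fin.last n) = 0 := le_antisymm h1 h0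
      rw [hl, sub_zero, Set.zero_smul_set hne, Set.mem_zero] at h2
      rw [← Fin.snoc_init_self x, hl, h2]
      funext i
      refine Fin.lastCases ?_ (fun i => ?_) i <;> simp
  · have hlast : (t⁻¹ • x) (Fin.last n) = t⁻¹ * x (Fin.last n) := rfl
    have hinit : (Fin.init (t⁻¹ • x) : Fin n → ℝ) = t⁻¹ • (Fin.init x : Fin n → ℝ) := rfl
    have hscale : 1 - t⁻¹ * x (Fin.last n) = t⁻¹ * (t - x (Fin.last n)) := by
      field_simp
    rw [Set.mem_smul_set_iff_inv_smul_mem₀ ht.ne', mem_pyr_iff hP hne, hlast, hinit, hscale,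
      mul_smul, Set.smul_mem_smul_set_iff₀ (inv_ne_zero ht.ne'),
      mul_nonneg_iff_of_pos_left (inv_pos.mpr ht), inv_mul_le_iff₀ ht, mul_one]

lemma convex_pyrIter {n : ℕ} {P : Set (Fin n → ℝ)} (hP : Convex ℝ P) (k : ℕ) :
    Convex ℝ (pyrIter k P) := by
  cases k with
  | zero => exact hP
  | succ k => exact convex_convexHull ℝ _

lemma nonempty_pyrIter {n : ℕ} {P : Set (Fin n → ℝ)} (hP : P.Nonempty) (k : ℕ) :
    (pyrIter k P).Nonempty := by
  cases k with
  | zero => exact hP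
  | succ k => exact ⟨_, subset_convexHull ℝ _ (Or.inr rfl)⟩

lemma snoc_mem_latticePoints_pyr_iff {n : ℕ} {P : Set (Fin n → ℝ)} (hP : Convex ℝ P)
    (hne : P.Nonempty) (t : ℕ) (z : Fin n → ℤ) (w : ℤ) :
    (Fin.snoc z w : Fin (n + 1) → ℤ) ∈ latticePoints (pyr P) t ↔
      0 ≤ w ∧ w ≤ t ∧ (fun i => (z i : ℝ)) ∈ ((t : ℝ) - w) • P := by
  rw [latticePoints, Set.mem_ofPred_eq, mem_smul_pyr_iff hP hne (Nat.cast_nonneg t)]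
  have hinit : (Fin.init fun i => (((Fin.snoc z w : Fin (n + 1) → ℤ) i : ℤ) : ℝ)) =
      fun i => (z i : ℝ) := by
    funext i
    simp [Fin.init]
  rw [hinit, Fin.snoc_last]
  norm_cast

/-- Slicing the lattice points of a dilated pyramid by height. -/
noncomputable def latticePointsPyrEquiv {n : ℕ} {P : Set (Fin n → ℝ)} (hP : Convex ℝ P)
    (hne : P.Nonempty) (t : ℕ) :
    (Σ w : Fin (t + 1), latticePoints P (t - w)) ≃ latticePoints (pyr P) t :=
  Equiv.ofBijective
    (fun p => ⟨Fin.snoc (p.2 : Fin n → ℤ) ((p.1 : ℕ) : ℤ), by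
      obtain ⟨w, z, hz⟩ := p
      have hw : (w : ℕ) ≤ t := Nat.lt_succ_iff.mp w.2
      rw [snoc_mem_latticePoints_pyr_iff hP hne]
      refine ⟨by positivity, by exact_mod_cast hw, ?_⟩
      rw [latticePoints, Set.mem_ofPred_eq, Nat.cast_sub hw] at hz
      exact_mod_cast hz⟩)
    (by
      constructor
      · rintro ⟨w, z, hz⟩ ⟨w', z', hz'⟩ h
        have h := Fin.snoc_injective2 (α := fun _ => ℤ) (congrArg Subtype.val h)
        obtain rfl : w = w' := Fin.ext (by exact_mod_cast h.2)
        obtain rfl : z = z' := h.1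
        rfl
      · rintro ⟨x, hx⟩
        obtain ⟨z, w, rfl⟩ : ∃ z w, x = Fin.snoc (α := fun _ => ℤ) z w :=
          ⟨_, _, (Fin.snoc_init_self x).symm⟩
        have hx' := hx
        rw [snoc_mem_latticePoints_pyr_iff hP hne] at hx'
        obtain ⟨h0, h1, h2⟩ := hx'
        lift w to ℕ using h0
        have hw : w ≤ t := by exact_mod_cast h1
        refine ⟨⟨⟨w, by omega⟩, z, ?_⟩, rfl⟩
        rw [latticePoints, Set.mem_ofPred_eq, Nat.cast_sub hw]
        exact_mod_cast h2)

lemma card_latticePoints_pyr {n : ℕ} {P : Set (Fin n → ℝ)} (hP : Convex ℝ P) (hne : P.Nonempty)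
    (hfin : ∀ t, Finite (latticePoints P t)) (t : ℕ) :
    Nat.card (latticePoints (pyr P) t) =
      ∑ s ∈ Finset.range (t + 1), Nat.card (latticePoints P s) := by
  rw [← Nat.card_congr (latticePointsPyrEquiv hP hne t), Nat.card_sigma,
    Fin.sum_univ_eq_sum_range (fun w => Nat.card (latticePoints P (t - w))),
    ← Finset.sum_range_reflect]
  refine Finset.sum_congr rfl fun s hs => ?_
  rw [Finset.mem_range] at hs
  rw [show t - (t + 1 - 1 - s) = s by omega]

lemma finite_latticePoints_pyr {n : ℕ} {P : Set (Fin n → ℝ)} (hP : Convex ℝ P) (hne : P.Nonempty)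
    (hfin : ∀ t, Finite (latticePoints P t)) (t : ℕ) : Finite (latticePoints (pyr P) t) :=
  Finite.of_equiv _ (latticePointsPyrEquiv hP hne t)

lemma sum_range_choose_add (a k t : ℕ) (h : a ≤ k) :
    ∑ s ∈ Finset.range (t + 1), (s + a).choose k = (t + a + 1).choose (k + 1) := by
  induction t with
  | zero =>
    rcases h.eq_or_lt with rfl | h
    · simp
    · simp [Nat.choose_eq_zero_of_lt h, Nat.choose_eq_zero_of_lt (by omega : a + 1 < k + 1)]
  | succ t ih =>
    rw [Finset.sum_range_succ, ih, Nat.choose_succ_succ' (t + 1 + a) k, add_comm]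
    congr 2
    ring

lemma card_latticePoints_pyrIter {P : Set (Fin 3 → ℝ)} (hP : Convex ℝ P) (hne : P.Nonempty)
    (m : ℕ) (hfin : ∀ t, Finite (latticePoints P t))
    (hcard : ∀ t, Nat.card (latticePoints P t) = (t + 3).choose 3 + m * (t + 1).choose 3)
    (k : ℕ) :
    ∀ t, Finite (latticePoints (pyrIter k P) t) ∧ Nat.card (latticePoints (pyrIter k P) t) =
      (t + k + 3).choose (k + 3) + m * (t + k + 1).choose (k + 3) := by
  induction k with
  | zero =>
    intro t
    simpa using ⟨hfin t, hcard t⟩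
  | succ k ih =>
    have hc := convex_pyrIter hP k
    have hn := nonempty_pyrIter hne k
    have hf := fun t => (ih t).1
    intro t
    refine ⟨finite_latticePoints_pyr hc hn hf t, ?_⟩
    refine (card_latticePoints_pyr hc hn hf t).trans ?_
    rw [Finset.sum_congr rfl fun s _ => (ih s).2, Finset.sum_add_distrib, ← Finset.mul_sum]
    have h1 := sum_range_choose_add (k + 3) (k + 3) t le_rfl
    have h2 := sum_range_choose_add (k + 1) (k + 3) t (by omega)
    simp only [← add_assoc] at h1 h2 ⊢
    rw [h1, h2]

lemma mem_smul_setProd_iff {a b : ℕ} (P : Set (Fin a → ℝ)) (Q : Set (Fin b → ℝ)) (t : ℝ)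
    (z : Fin (a + b) → ℝ) :
    z ∈ t • setProd P Q ↔
      (fun i => z (Fin.castAdd b i)) ∈ t • P ∧ (fun j => z (Fin.natAdd a j)) ∈ t • Q := by
  constructor
  · rintro ⟨y, ⟨h1, h2⟩, rfl⟩
    exact ⟨⟨_, h1, rfl⟩, ⟨_, h2, rfl⟩⟩
  · rintro ⟨⟨p, hp, h1⟩, ⟨q, hq, h2⟩⟩
    refine ⟨Fin.append p q, ⟨by simpa using hp, by simpa using hq⟩, ?_⟩
    funext i
    refine Fin.addCases (fun i => ?_) (fun i => ?_) i
    · simpa using congrFun h1 i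
    · simpa using congrFun h2 i

lemma card_latticePoints_setProd {a b : ℕ} (P : Set (Fin a → ℝ)) (Q : Set (Fin b → ℝ)) (t : ℕ) :
    Nat.card (latticePoints (setProd P Q) t) =
      Nat.card (latticePoints P t) * Nat.card (latticePoints Q t) := by
  rw [← Nat.card_prod, ← Nat.card_congr (Equiv.Set.prod _ _)]
  refine (Nat.card_congr ((Fin.appendEquiv a b).subtypeEquiv fun x => ?_)).symm
  change _ ↔ _ ∈ (t : ℝ) • setProd P Q
  rw [mem_smul_setProd_iff]
  simp [Fin.appendEquiv, latticePoints]

lemma card_latticePoints_cube (n t : ℕ) :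
    Nat.card (latticePoints (cube n) t) = (n * t + 1) ^ n := by
  have h : latticePoints (cube n) t =
      ((Fintype.piFinset fun _ : Fin n => Finset.Icc (0 : ℤ) (n * t)) : Set (Fin n → ℤ)) := by
    ext z
    rw [Finset.mem_coe, Fintype.mem_piFinset]
    simp only [Finset.mem_Icc]
    constructor
    · rintro ⟨y, hy, hz⟩ i
      have hi : (t : ℝ) * y i = z i := congrFun hz i
      have h0 := (hy i).1
      have h1 := (hy i).2
      have ht : (0 : ℝ) ≤ t := Nat.cast_nonneg t
      constructor
      · have : (0 : ℝ) ≤ z i := by rw [← hi]; positivity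
        exact_mod_cast this
      · have : (z i : ℝ) ≤ n * t := by rw [← hi]; nlinarith
        exact_mod_cast this
    · intro hz
      rcases Nat.eq_zero_or_pos t with rfl | ht
      · refine ⟨0, fun i => by simp, ?_⟩
        funext i
        have := hz i
        have : z i = 0 := by simp at this; omega
        simp [this]
      · have ht' : (0 : ℝ) < t := by exact_mod_cast ht
        refine ⟨fun i => z i / t, fun i => ⟨?_, ?_⟩, ?_⟩
        · have : (0 : ℝ) ≤ z i := by exact_mod_cast (hz i).1
          positivity
        · have : (z i : ℝ) ≤ n * t := by exact_mod_cast (hz i).2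
          rw [div_le_iff₀ ht']
          exact this
        · funext i
          simp
          field_simp
  rw [h, Nat.card_coe_set_eq, Set.ncard_coe_finset, Fintype.card_piFinset]
  simp
  norm_cast

end Geometry

section Reeve

lemma mem_smul_reeve_iff {m : ℕ} (hm : 0 < m) {t : ℝ} (ht : 0 ≤ t) (x : Fin 3 → ℝ) :
    x ∈ t • reeve m ↔
      0 ≤ x 2 ∧ x 2 ≤ m * x 0 ∧ x 2 ≤ m * x 1 ∧ m * (x 0 + x 1) ≤ m * t + x 2 := by
  have hm' : (0 : ℝ) < m := by exact_mod_cast hm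
  have hconv : Convex ℝ (reeve m) := convex_convexHull ℝ _
  have hO : ![0, 0, 0] ∈ reeve m := subset_convexHull ℝ _ (by simp)
  have hA : ![1, 0, 0] ∈ reeve m := subset_convexHull ℝ _ (by simp)
  have hB : ![0, 1, 0] ∈ reeve m := subset_convexHull ℝ _ (by simp)
  have hC : ![1, 1, (m : ℝ)] ∈ reeve m := subset_convexHull ℝ _ (by simp)
  constructor
  · rintro ⟨y, hy, rfl⟩
    have hy' : 0 ≤ y 2 ∧ y 2 ≤ m * y 0 ∧ y 2 ≤ m * y 1 ∧ m * (y 0 + y 1) ≤ m + y 2 := by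
      refine convexHull_min (t := {y : Fin 3 → ℝ | 0 ≤ y 2 ∧ y 2 ≤ m * y 0 ∧ y 2 ≤ m * y 1 ∧
        m * (y 0 + y 1) ≤ m + y 2}) ?_ ?_ hy
      · rintro _ (rfl | rfl | rfl | rfl) <;> simp [mul_add]
      · rintro y ⟨h1, h2, h3, h4⟩ z ⟨k1, k2, k3, k4⟩ a b ha hb hab
        have hs : (m : ℝ) = a * m + b * m := by linear_combination (-(m : ℝ)) * hab
        simp only [Set.mem_ofPred_eq, Pi.add_apply, Pi.smul_apply, smul_eq_mul]
        refine ⟨by positivity, ?_, ?_, ?_⟩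
        · linarith [mul_le_mul_of_nonneg_left h2 ha, mul_le_mul_of_nonneg_left k2 hb]
        · linarith [mul_le_mul_of_nonneg_left h3 ha, mul_le_mul_of_nonneg_left k3 hb]
        · linarith [mul_le_mul_of_nonneg_left h4 ha, mul_le_mul_of_nonneg_left k4 hb]
    obtain ⟨h1, h2, h3, h4⟩ := hy'
    simp only [Pi.smul_apply, smul_eq_mul]
    refine ⟨by positivity, ?_, ?_, ?_⟩
    · linarith [mul_le_mul_of_nonneg_left h2 ht]
    · linarith [mul_le_mul_of_nonneg_left h3 ht]
    · linarith [mul_le_mul_of_nonneg_left h4 ht]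
  · rintro ⟨h1, h2, h3, h4⟩
    set d := x 2 / m with hd
    have hx2 : x 2 = m * d := by rw [hd]; field_simp
    have hd0 : 0 ≤ d := by positivity
    rw [hx2] at h2 h3 h4
    have h2' : 0 ≤ x 0 - d := sub_nonneg.mpr (le_of_mul_le_mul_left h2 hm')
    have h3' : 0 ≤ x 1 - d := sub_nonneg.mpr (le_of_mul_le_mul_left h3 hm')
    have h4' : 0 ≤ t + d - (x 0 + x 1) :=
      sub_nonneg.mpr (le_of_mul_le_mul_left (by rw [mul_add _ t]; exact h4) hm')
    have hsum : t = (t + d - (x 0 + x 1)) + ((x 0 - d) + ((x 1 - d) + d)) := by ring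
    have hx : x = (t + d - (x 0 + x 1)) • ![0, 0, 0] + ((x 0 - d) • ![1, 0, 0] +
        ((x 1 - d) • ![0, 1, 0] + d • ![1, 1, (m : ℝ)])) := by
      funext i
      fin_cases i
      · simp
      · simp
      · simp [hx2, mul_comm]
    have hset : t • reeve m = (t + d - (x 0 + x 1)) • reeve m + ((x 0 - d) • reeve m +
        ((x 1 - d) • reeve m + d • reeve m)) := by
      rw [← hconv.add_smul h3' hd0, ← hconv.add_smul h2' (by positivity),
        ← hconv.add_smul h4' (by positivity), ← hsum]
    rw [hset]
    exact ⟨_, Set.smul_mem_smul_set hO, _, Set.add_mem_add (Set.smul_mem_smul_set hA)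
      (Set.add_mem_add (Set.smul_mem_smul_set hB) (Set.smul_mem_smul_set hC)), hx.symm⟩

/-- Coordinates `(e, c, a, b)` for the lattice points of `t • T_m`: the third coordinate is
`m c + e` with `e < m`, and `a`, `b` measure the slack of the first two coordinates. -/
def reeveIndex (m t : ℕ) : Finset (Σ _ : ℕ, Σ _ : ℕ, Σ _ : ℕ, ℕ) :=
  (Finset.range m).sigma fun e =>
    (Finset.range (if e = 0 then t + 1 else t - 1)).sigma fun c =>
      (Finset.range ((if e = 0 then t + 1 else t - 1) - c)).sigma fun a =>
        Finset.range ((if e = 0 then t + 1 else t - 1) - c - a)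

/-- The lattice point of `t • T_m` with the given coordinates. -/
def reevePoint (m : ℕ) (p : Σ _ : ℕ, Σ _ : ℕ, Σ _ : ℕ, ℕ) : Fin 3 → ℤ :=
  ![p.2.2.1 + p.2.1 + (if p.1 = 0 then 0 else 1), p.2.2.2 + p.2.1 + (if p.1 = 0 then 0 else 1),
    m * p.2.1 + p.1]

lemma reevePoint_injOn (m t : ℕ) : Set.InjOn (reevePoint m) (reeveIndex m t) := by
  rintro ⟨e, c, a, b⟩ h ⟨e', c', a', b'⟩ h' heq
  simp only [reeveIndex, Finset.coe_sigma, Set.mem_sigma_iff, Finset.mem_coe,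
    Finset.mem_range] at h h'
  have h0 : (a + c + (if e = 0 then 0 else 1) : ℤ) = a' + c' + (if e' = 0 then 0 else 1) :=
    congrFun heq 0
  have h1 : (b + c + (if e = 0 then 0 else 1) : ℤ) = b' + c' + (if e' = 0 then 0 else 1) :=
    congrFun heq 1
  have h2 : (m * c + e : ℤ) = m * c' + e' := congrFun heq 2
  have h2' : m * c + e = m * c' + e' := by exact_mod_cast h2
  have hmod := congrArg (· % m) h2'
  simp only [Nat.mul_add_mod, Nat.mod_eq_of_lt h.1, Nat.mod_eq_of_lt h'.1] at hmod
  subst hmod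
  obtain rfl : c = c' := Nat.eq_of_mul_eq_mul_left (by omega : 0 < m) (by omega)
  obtain rfl : a = a' := by omega
  obtain rfl : b = b' := by omega
  rfl

lemma latticePoints_reeve {m : ℕ} (hm : 0 < m) (t : ℕ) :
    latticePoints (reeve m) t = reevePoint m '' (reeveIndex m t) := by
  ext z
  rw [latticePoints, Set.mem_ofPred_eq, mem_smul_reeve_iff hm (Nat.cast_nonneg t)]
  have hcast : (0 ≤ (z 2 : ℝ) ∧ (z 2 : ℝ) ≤ m * z 0 ∧ (z 2 : ℝ) ≤ m * z 1 ∧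
      m * ((z 0 : ℝ) + z 1) ≤ m * t + z 2) ↔
      (0 ≤ z 2 ∧ z 2 ≤ m * z 0 ∧ z 2 ≤ m * z 1 ∧ (m : ℤ) * (z 0 + z 1) ≤ m * t + z 2) := by
    norm_cast
  rw [hcast]
  have hmZ : (0 : ℤ) < m := by exact_mod_cast hm
  constructor
  · rintro ⟨h1, h2, h3, h4⟩
    set c := z 2 / m with hc
    set e := z 2 % m with he
    have hz2 : z 2 = m * c + e := (Int.mul_ediv_add_emod _ _).symm
    have hc0 : 0 ≤ c := Int.ediv_nonneg h1 hmZ.le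
    have he0 : 0 ≤ e := Int.emod_nonneg _ hmZ.ne'
    have hem : e < m := Int.emod_lt_of_pos _ hmZ
    clear_value c e
    lift c to ℕ using hc0
    lift e to ℕ using he0
    rw [hz2] at h2 h3 h4
    set δ : ℕ := if e = 0 then 0 else 1 with hδ
    have hx : (c : ℤ) + δ ≤ z 0 := by
      rw [hδ]; split_ifs with h
      · subst h; push_cast at *; nlinarith
      · have : (0 : ℤ) < e := by omega
        push_cast
        by_contra! hcon
        nlinarith
    have hy : (c : ℤ) + δ ≤ z 1 := by
      rw [hδ]; split_ifs with h
      · subst h; push_cast at *; nlinarith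
      · have : (0 : ℤ) < e := by omega
        push_cast
        by_contra! hcon
        nlinarith
    have hxy : z 0 + z 1 ≤ t + c := by
      by_contra! hcon
      nlinarith
    obtain ⟨a, ha⟩ := Int.eq_ofNat_of_zero_le (sub_nonneg.mpr hx)
    obtain ⟨b, hb⟩ := Int.eq_ofNat_of_zero_le (sub_nonneg.mpr hy)
    refine ⟨⟨e, c, a, b⟩, ?_, ?_⟩
    · simp only [reeveIndex, Finset.coe_sigma, Set.mem_sigma_iff, Finset.mem_coe,
        Finset.mem_range]
      split_ifs at hδ ⊢ <;> omega
    · funext i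
      fin_cases i
      · simp [reevePoint]
        split_ifs at hδ ⊢ <;> omega
      · simp [reevePoint]
        split_ifs at hδ ⊢ <;> omega
      · simp [reevePoint, hz2]
  · rintro ⟨⟨e, c, a, b⟩, h, rfl⟩
    simp only [reeveIndex, Finset.coe_sigma, Set.mem_sigma_iff, Finset.mem_coe,
      Finset.mem_range] at h
    obtain ⟨he, hc, ha, hb⟩ := h
    have heZ : (e : ℤ) < m := by exact_mod_cast he
    have h0 : reevePoint m ⟨e, c, a, b⟩ 0 = a + c + (if e = 0 then 0 else 1) := rfl
    have h1 : reevePoint m ⟨e, c, a, b⟩ 1 = b + c + (if e = 0 then 0 else 1) := rfl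
    have h2 : reevePoint m ⟨e, c, a, b⟩ 2 = m * c + e := rfl
    rw [h0, h1, h2]
    split_ifs at * with h
    · subst h
      have : (a : ℤ) + b + c ≤ t := by omega
      push_cast
      refine ⟨by positivity, by nlinarith, by nlinarith, by nlinarith⟩
    · have : (a : ℤ) + b + c + 2 ≤ t := by omega
      refine ⟨by positivity, by nlinarith, by nlinarith, by nlinarith⟩

lemma sum_range_sub (f : ℕ → ℕ) (n : ℕ) :
    ∑ i ∈ Finset.range n, f (n - i) = ∑ i ∈ Finset.range n, f (i + 1) := by
  rw [← Finset.sum_range_reflect]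
  refine Finset.sum_congr rfl fun i hi => ?_
  rw [Finset.mem_range] at hi
  rw [show n - (n - 1 - i) = i + 1 by omega]

lemma sum_range_choose_succ (n k : ℕ) :
    ∑ i ∈ Finset.range n, (i + 1 + k).choose (k + 1) = (n + k + 1).choose (k + 2) := by
  cases n with
  | zero => simp
  | succ n =>
    have h := sum_range_choose_add (k + 1) (k + 1) n le_rfl
    rw [← h.trans (congrArg₂ _ (by ring) rfl)]
    exact Finset.sum_congr rfl fun i _ => congrArg₂ _ (by ring) rfl

lemma sum_sum_range_sub (n : ℕ) :
    ∑ c ∈ Finset.range n, ∑ a ∈ Finset.range (n - c), (n - c - a) = (n + 2).choose 3 := by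
  have h1 : ∀ k, ∑ a ∈ Finset.range k, (k - a) = (k + 1).choose 2 := by
    intro k
    rw [sum_range_sub (fun i => i), ← sum_range_choose_succ k 0]
    simp
  rw [Finset.sum_congr rfl fun c _ => h1 (n - c), sum_range_sub fun i => (i + 1).choose 2]
  exact sum_range_choose_succ n 1

lemma card_reeveIndex (m t : ℕ) :
    (reeveIndex (m + 1) t).card = (t + 3).choose 3 + m * (t + 1).choose 3 := by
  have h : (t - 1 + 2).choose 3 = (t + 1).choose 3 := by
    cases t <;> rfl
  simp only [reeveIndex, Finset.card_sigma, Finset.card_range, sum_sum_range_sub]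
  rw [Finset.sum_range_succ']
  simp [h, add_comm]

lemma finite_latticePoints_reeve {m : ℕ} (hm : 0 < m) (t : ℕ) :
    Finite (latticePoints (reeve m) t) := by
  rw [latticePoints_reeve hm]
  exact ((reeveIndex m t).finite_toSet.image _).to_subtype

lemma card_latticePoints_reeve (m t : ℕ) :
    Nat.card (latticePoints (reeve (m + 1)) t) = (t + 3).choose 3 + m * (t + 1).choose 3 := by
  rw [latticePoints_reeve m.succ_pos, Nat.card_coe_set_eq, Set.InjOn.ncard_image
    (reevePoint_injOn _ _), Set.ncard_coe_finset, card_reeveIndex]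

end Reeve

section Polytope

lemma IsIntegralPolytope.of_finite {N : ℕ} {V : Set (Fin N → ℝ)} (hV : V.Finite)
    (hcoord : ∀ v ∈ V, ∀ i, ∃ z : ℤ, v i = (z : ℝ)) : IsIntegralPolytope (convexHull ℝ V) :=
  ⟨hV.toFinset, by simpa using hcoord, by simp⟩

lemma IsIntegralPolytope.pyr {n : ℕ} {P : Set (Fin n → ℝ)} (hP : IsIntegralPolytope P) :
    IsIntegralPolytope (pyr P) := by
  obtain ⟨V, hV, rfl⟩ := hP
  rw [pyr_eq_convexHull_image_union, LinearMap.image_convexHull, convexHull_convexHull_union_left]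
  refine .of_finite ((V.finite_toSet.image _).union (Set.finite_singleton _)) ?_
  rintro _ (⟨v, hv, rfl⟩ | rfl) i
  · refine Fin.lastCases ⟨0, by simp [snocZero]⟩ (fun i => ?_) i
    simpa [snocZero] using hV v hv i
  · exact Fin.lastCases ⟨1, by simp⟩ (fun i => ⟨0, by simp⟩) i

lemma IsIntegralPolytope.pyrIter {n : ℕ} {P : Set (Fin n → ℝ)} (hP : IsIntegralPolytope P)
    (k : ℕ) : IsIntegralPolytope (pyrIter k P) := by
  induction k with
  | zero => exact hP
  | succ k ih => exact ih.pyr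

lemma IsIntegralPolytope.setProd {a b : ℕ} {P : Set (Fin a → ℝ)} {Q : Set (Fin b → ℝ)}
    (hP : IsIntegralPolytope P) (hQ : IsIntegralPolytope Q) : IsIntegralPolytope (setProd P Q) := by
  obtain ⟨V, hV, rfl⟩ := hP
  obtain ⟨W, hW, rfl⟩ := hQ
  rw [setProd_eq_image, ← convexHull_prod, LinearMap.image_convexHull]
  refine .of_finite ((V.finite_toSet.prod W.finite_toSet).image _) ?_
  rintro _ ⟨⟨v, w⟩, ⟨hv, hw⟩, rfl⟩ i
  refine Fin.addCases (fun i => ?_) (fun i => ?_) i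
  · simpa [appendLinear] using hV v hv i
  · simpa [appendLinear] using hW w hw i

lemma isIntegralPolytope_reeve (m : ℕ) : IsIntegralPolytope (reeve m) := by
  refine .of_finite (Set.toFinite _) ?_
  rintro _ (rfl | rfl | rfl | rfl) i
  · exact ⟨![0, 0, 0] i, by fin_cases i <;> simp⟩
  · exact ⟨![1, 0, 0] i, by fin_cases i <;> simp⟩
  · exact ⟨![0, 1, 0] i, by fin_cases i <;> simp⟩
  · exact ⟨![1, 1, (m : ℤ)] i, by fin_cases i <;> simp⟩

lemma isIntegralPolytope_cube (n : ℕ) : IsIntegralPolytope (cube n) := by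
  have h : cube n = convexHull ℝ (Set.univ.pi fun _ : Fin n => {(0 : ℝ), (n : ℝ)}) := by
    rw [convexHull_pi]
    ext x
    simp only [cube, convexHull_pair, segment_eq_Icc (Nat.cast_nonneg (α := ℝ) n), Set.mem_pi,
      Set.mem_univ, true_imp_iff, Set.mem_ofPred_eq]
  rw [h]
  refine .of_finite (Set.Finite.pi fun _ => Set.toFinite _) ?_
  intro v hv i
  rcases hv i trivial with h | h
  · exact ⟨0, by simpa using h⟩
  · exact ⟨n, by simpa using h⟩

lemma span_pyr_eq_top {n : ℕ} {P : Set (Fin n → ℝ)} (hP : Submodule.span ℝ P = ⊤) :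
    Submodule.span ℝ (pyr P) = ⊤ := by
  rw [Submodule.eq_top_iff']
  intro x
  have hx := snoc_eq_smul_add_smul (Fin.init x : Fin n → ℝ) 1 (x (Fin.last n))
  rw [one_smul, one_smul, Fin.snoc_init_self] at hx
  rw [hx]
  refine add_mem ?_ (Submodule.smul_mem _ _ (Submodule.subset_span
    (subset_convexHull ℝ _ (Or.inr rfl))))
  have hmem : snocZero n (Fin.init x) ∈ (Submodule.span ℝ P).map (snocZero n) :=
    ⟨_, hP ▸ Submodule.mem_top, rfl⟩
  rw [Submodule.map_span] at hmem
  exact Submodule.span_mono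
    (fun y hy => subset_convexHull ℝ _ (Or.inl hy)) hmem

lemma zero_mem_pyr {n : ℕ} {P : Set (Fin n → ℝ)} (hP : 0 ∈ P) : 0 ∈ pyr P :=
  subset_convexHull ℝ _ (Or.inl ⟨0, hP, (snocZero n).map_zero⟩)

lemma zero_mem_and_span_pyrIter {n : ℕ} {P : Set (Fin n → ℝ)} (h0 : 0 ∈ P)
    (hP : Submodule.span ℝ P = ⊤) (k : ℕ) :
    0 ∈ pyrIter k P ∧ Submodule.span ℝ (pyrIter k P) = ⊤ := by
  induction k with
  | zero => exact ⟨h0, hP⟩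
  | succ k ih => exact ⟨zero_mem_pyr ih.1, span_pyr_eq_top ih.2⟩

lemma span_setProd_eq_top {a b : ℕ} {P : Set (Fin a → ℝ)} {Q : Set (Fin b → ℝ)}
    (hP0 : 0 ∈ P) (hQ0 : 0 ∈ Q) (hP : Submodule.span ℝ P = ⊤) (hQ : Submodule.span ℝ Q = ⊤) :
    Submodule.span ℝ (setProd P Q) = ⊤ := by
  have hsurj : LinearMap.range (appendLinear a b) = ⊤ := by
    rw [LinearMap.range_eq_top]
    exact fun z => ⟨(fun i => z (Fin.castAdd b i), fun j => z (Fin.natAdd a j)),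
      Fin.append_castAdd_natAdd⟩
  have hspan : Submodule.span ℝ (P ×ˢ Q) = ⊤ := by
    rw [Submodule.span_prod_eq ℝ hP0 hQ0, hP, hQ, Submodule.prod_top]
  rw [setProd_eq_image, ← Submodule.map_span, hspan, Submodule.map_top, hsurj]

lemma zero_mem_reeve (m : ℕ) : 0 ∈ reeve m := by
  refine subset_convexHull ℝ _ (Or.inl ?_)
  funext i
  fin_cases i <;> rfl

lemma span_reeve_eq_top {m : ℕ} (hm : 0 < m) : Submodule.span ℝ (reeve m) = ⊤ := by
  have hm' : (m : ℝ) ≠ 0 := by exact_mod_cast hm.ne'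
  rw [Submodule.eq_top_iff']
  intro x
  have hx : x = (x 0 - x 2 / m) • ![1, 0, 0] +
      ((x 1 - x 2 / m) • ![0, 1, 0] + (x 2 / m) • ![1, 1, (m : ℝ)]) := by
    funext i
    fin_cases i <;> simp [hm']
  have h : ∀ v ∈ ({![0, 0, 0], ![1, 0, 0], ![0, 1, 0], ![1, 1, (m : ℝ)]} : Set (Fin 3 → ℝ)),
      v ∈ Submodule.span ℝ (reeve m) := fun v hv =>
    Submodule.subset_span (subset_convexHull ℝ _ hv)
  rw [hx]
  exact add_mem (Submodule.smul_mem _ _ (h _ (by simp))) (add_mem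
    (Submodule.smul_mem _ _ (h _ (by simp))) (Submodule.smul_mem _ _ (h _ (by simp))))

lemma zero_mem_cube (n : ℕ) : 0 ∈ cube n := fun i => by simp

lemma span_cube_eq_top {n : ℕ} (hn : 1 ≤ n) : Submodule.span ℝ (cube n) = ⊤ := by
  rw [eq_top_iff, ← (Pi.basisFun ℝ (Fin n)).span_eq, Submodule.span_le]
  rintro _ ⟨i, rfl⟩
  refine Submodule.subset_span fun j => ?_
  have hn' : (1 : ℝ) ≤ n := by exact_mod_cast hn
  rw [Pi.basisFun_apply, Pi.single_apply]
  split_ifs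
  · exact ⟨zero_le_one, hn'⟩
  · exact ⟨le_rfl, by linarith⟩

lemma affineSpan_eq_top_of_span {N : ℕ} {P : Set (Fin N → ℝ)} (h0 : 0 ∈ P)
    (hP : Submodule.span ℝ P = ⊤) : affineSpan ℝ P = ⊤ := by
  have h := affineSpan_insert_zero (k := ℝ) P
  rw [Set.insert_eq_of_mem h0, hP] at h
  exact SetLike.coe_injective (by rw [h]; rfl)

end Polytope

/-- For `P = Pyr^r(T_m) × [0,n]^n` and all sufficiently large `m`,
the coefficients of `t, t², …, t^{n+1}` in `i(P,t)` are all negative. -/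
theorem low_coeffs_negative (n r : ℕ) (hn : 1 ≤ n) (hr : 1 ≤ r) :
    ∃ M : ℕ, 0 < M ∧ ∀ m : ℕ, M ≤ m →
      IsIntegralPolytope (setProd (pyrIter r (reeve m)) (cube n)) ∧
      affineSpan ℝ (setProd (pyrIter r (reeve m)) (cube n)) = ⊤ ∧
      ∃ p : Polynomial ℚ,
        p.natDegree = n + r + 3 ∧ p.coeff 0 = 1 ∧
        (∀ t : ℕ, 0 < t →
          (latticeCount (setProd (pyrIter r (reeve m)) (cube n)) t : ℚ) =
            p.eval (t : ℚ)) ∧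
        (∀ j : ℕ, 1 ≤ j → j ≤ n + 1 → p.coeff j < 0) := by
  obtain ⟨M, hM⟩ := exists_pyrReevePoly_coeff_neg (r := r) hn
  refine ⟨M + 1, M.succ_pos, fun m hm => ?_⟩
  obtain ⟨m, rfl⟩ : ∃ k, m = k + 1 := ⟨m - 1, by omega⟩
  obtain ⟨h0, hspan⟩ :=
    zero_mem_and_span_pyrIter (zero_mem_reeve (m + 1)) (span_reeve_eq_top m.succ_pos) r
  refine ⟨((isIntegralPolytope_reeve _).pyrIter r).setProd (isIntegralPolytope_cube n),
    affineSpan_eq_top_of_span ⟨h0, zero_mem_cube n⟩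
      (span_setProd_eq_top h0 (zero_mem_cube n) hspan (span_cube_eq_top hn)),
    pyrReevePoly n r m, pyrReevePoly_natDegree hn r m, pyrReevePoly_coeff_zero n r m,
    fun t _ => ?_, hM m (by omega)⟩
  rw [latticeCount_eq_card, card_latticePoints_setProd, card_latticePoints_cube,
    (card_latticePoints_pyrIter (P := reeve (m + 1)) (convex_convexHull ℝ _) ⟨0, zero_mem_reeve (m + 1)⟩ m
      (finite_latticePoints_reeve m.succ_pos) (card_latticePoints_reeve m) r t).2,
    pyrReevePoly_eval]
  push_cast
  rfl
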